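/- For every k ∈ ℕ, the point z̄ = (x̄, ȳ, p̄₀, t̄, s̄) with x̄ = ȳ = 0, p̄₀ = (1/6, 1/6), t̄ = (1/30)·1_k, s̄ = 1/3 satisfies z̄ + (1/30)·B_∞^{k+5} ⊆ P, where P ⊂ ℝ^{k+5} is the polytope defined by the construction below and B_∞^{k+5} = {x ∈ ℝ^{k+5} : ‖x‖_∞ ≤ 1}. -/

import Mathlib

open Set

noncomputable section

/-- The angle `π / 2^(j+2)` used in the construction (paper index `j`). -/
def ang (j : ℕ) : ℝ := Real.pi / 2 ^ (j + 2)

/-- `w_jᵀ q` where `w_j = (cos(π/2^(j+2)), sin(π/2^(j+2)))`. -/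
def wdot (j : ℕ) (q : ℝ × ℝ) : ℝ := Real.cos (ang j) * q.1 + Real.sin (ang j) * q.2

/-- `v_jᵀ q` where `v_j = (sin(π/2^(j+2)), -cos(π/2^(j+2)))`. -/
def vdot (j : ℕ) (q : ℝ × ℝ) : ℝ := Real.sin (ang j) * q.1 - Real.cos (ang j) * q.2

/-- The linear system defining `P' ⊆ ℝ^{3k+5}`: for `i : Fin k` the paper index is
`(i : ℕ) + 1 ∈ [k]`, `p_j` is `p ⟨j⟩ : ℝ × ℝ`, and the constraints are
`e₁ᵀp₀ ≥ |x|`, `e₂ᵀp₀ ≥ |y|`, `w_jᵀp_j = w_jᵀp_{j-1}`, `t_j + j·s = v_jᵀp_j ≥ |v_jᵀp_{j-1}|`,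
`e₁ᵀp_k ≤ 1`, `0 ≤ t ≤ 1`, `0 ≤ s ≤ 1`. -/
def SatP' (k : ℕ) (x y : ℝ) (p : Fin (k + 1) → ℝ × ℝ) (t : Fin k → ℝ) (s : ℝ) : Prop :=
  |x| ≤ (p 0).1 ∧ |y| ≤ (p 0).2 ∧
  (∀ i : Fin k, wdot ((i : ℕ) + 1) (p i.succ) = wdot ((i : ℕ) + 1) (p i.castSucc)) ∧
  (∀ i : Fin k, t i + ((i : ℕ) + 1) * s = vdot ((i : ℕ) + 1) (p i.succ)) ∧
  (∀ i : Fin k, |vdot ((i : ℕ) + 1) (p i.castSucc)| ≤ vdot ((i : ℕ) + 1) (p i.succ)) ∧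
  (p (Fin.last k)).1 ≤ 1 ∧
  (∀ i : Fin k, 0 ≤ t i ∧ t i ≤ 1) ∧
  0 ≤ s ∧ s ≤ 1

/-- Membership in the projected polytope `P ⊆ ℝ^{k+5}` (coordinates `x, y, p₀, t, s`). -/
def memP (k : ℕ) (x y : ℝ) (p0 : ℝ × ℝ) (t : Fin k → ℝ) (s : ℝ) : Prop :=
  ∃ p : Fin (k + 1) → ℝ × ℝ, p 0 = p0 ∧ SatP' k x y p t s

/-- The recursively determined points `p_n`: `p_{n+1}` has the same `w_{n+1}`-component as `p_n`,
and `v_{n+1}`-component `u n`. -/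
def liftPoint (u : ℕ → ℝ) (p0 : ℝ × ℝ) : ℕ → ℝ × ℝ
  | 0 => p0
  | n + 1 =>
    (Real.cos (ang (n + 1)) * wdot (n + 1) (liftPoint u p0 n) + Real.sin (ang (n + 1)) * u n,
     Real.sin (ang (n + 1)) * wdot (n + 1) (liftPoint u p0 n) - Real.cos (ang (n + 1)) * u n)

theorem ang_pos (j : ℕ) : 0 < ang j := by
  unfold ang
  positivity

theorem ang_le (j : ℕ) : ang j ≤ 4 / 5 / 2 ^ j := by
  unfold ang
  rw [pow_add, div_le_div_iff₀ (by positivity) (by positivity)]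
  have h : (0 : ℝ) < 2 ^ j := by positivity
  nlinarith [Real.pi_lt_d2]

theorem ang_eq_two_mul (j : ℕ) : ang j = 2 * ang (j + 1) := by
  unfold ang
  field_simp
  ring

theorem ang_le_four_fifths (j : ℕ) : ang j ≤ 4 / 5 :=
  (ang_le j).trans (div_le_self (by norm_num) (one_le_pow₀ (by norm_num)))

theorem sin_ang_nonneg (j : ℕ) : 0 ≤ Real.sin (ang j) :=
  Real.sin_nonneg_of_nonneg_of_le_pi (ang_pos j).le
    (by linarith [ang_le_four_fifths j, Real.pi_gt_three])

theorem cos_ang_nonneg (j : ℕ) : 0 ≤ Real.cos (ang j) :=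
  Real.cos_nonneg_of_neg_pi_div_two_le_of_le
    (by linarith [ang_pos j, Real.pi_gt_three])
    (by linarith [ang_le_four_fifths j, Real.pi_gt_three])

theorem sin_ang_le (j : ℕ) : Real.sin (ang j) ≤ 4 / 5 / 2 ^ j :=
  (Real.sin_le (ang_pos j).le).trans (ang_le j)

section liftPoint

variable (u : ℕ → ℝ) (p0 : ℝ × ℝ) (n : ℕ)

theorem wdot_liftPoint_succ :
    wdot (n + 1) (liftPoint u p0 (n + 1)) = wdot (n + 1) (liftPoint u p0 n) := by
  rw [liftPoint]
  generalize wdot (n + 1) (liftPoint u p0 n) = a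
  simp only [wdot]
  linear_combination a * Real.sin_sq_add_cos_sq (ang (n + 1))

theorem vdot_liftPoint_succ : vdot (n + 1) (liftPoint u p0 (n + 1)) = u n := by
  rw [liftPoint]
  generalize wdot (n + 1) (liftPoint u p0 n) = a
  simp only [vdot]
  linear_combination u n * Real.sin_sq_add_cos_sq (ang (n + 1))

theorem wdot_next_liftPoint_succ :
    wdot (n + 2) (liftPoint u p0 (n + 1)) =
      Real.cos (ang (n + 2)) * wdot (n + 1) (liftPoint u p0 n) +
        Real.sin (ang (n + 2)) * u n := by
  rw [liftPoint]
  generalize wdot (n + 1) (liftPoint u p0 n) = a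
  simp only [wdot]
  rw [ang_eq_two_mul (n + 1), Real.cos_two_mul, Real.sin_two_mul]
  linear_combination 2 * a * Real.cos (ang (n + 2)) *
    (Real.sin_sq_add_cos_sq (ang (n + 2)))

theorem vdot_next_liftPoint_succ :
    vdot (n + 2) (liftPoint u p0 (n + 1)) =
      Real.cos (ang (n + 2)) * u n -
        Real.sin (ang (n + 2)) * wdot (n + 1) (liftPoint u p0 n) := by
  rw [liftPoint]
  generalize wdot (n + 1) (liftPoint u p0 n) = a
  simp only [vdot]
  rw [ang_eq_two_mul (n + 1), Real.cos_two_mul, Real.sin_two_mul]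
  linear_combination 2 * u n * Real.cos (ang (n + 2)) *
    (Real.sin_sq_add_cos_sq (ang (n + 2)))

end liftPoint

theorem wdot_liftPoint_bounds {u : ℕ → ℝ} {p0 : ℝ × ℝ}
    (hu0 : ∀ n, 0 ≤ u n) (hu : ∀ n : ℕ, u n ≤ (11 * (n + 1) + 2) / 30)
    (h1 : 0 ≤ p0.1) (h1' : p0.1 ≤ 1 / 5) (h2 : 0 ≤ p0.2) (h2' : p0.2 ≤ 1 / 5) (n : ℕ) :
    0 ≤ wdot (n + 1) (liftPoint u p0 n) ∧
      wdot (n + 1) (liftPoint u p0 n) +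
        4 / 5 / 2 ^ (n + 1) * ((11 * (n + 2) + 2) / 30) ≤ 18 / 25 := by
  induction n with
  | zero =>
    simp only [wdot, liftPoint]
    have hs := sin_ang_nonneg (0 + 1)
    have hc := cos_ang_nonneg (0 + 1)
    refine ⟨by positivity, ?_⟩
    have hs1 := mul_le_of_le_one_left h2 (Real.sin_le_one (ang (0 + 1)))
    have hc1 := mul_le_of_le_one_left h1 (Real.cos_le_one (ang (0 + 1)))
    norm_num at hs1 hc1 ⊢
    linarith
  | succ n ih =>
    rw [wdot_next_liftPoint_succ]
    obtain ⟨ha, hb⟩ := ih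
    have hs := sin_ang_nonneg (n + 2)
    have hc := cos_ang_nonneg (n + 2)
    have hun := hu0 n
    refine ⟨by positivity, ?_⟩
    have hc1 := mul_le_of_le_one_left ha (Real.cos_le_one (ang (n + 2)))
    have hs1 := mul_le_mul (sin_ang_le (n + 2)) (hu n) hun (by positivity)
    have hpow : (4 / 5 / 2 ^ (n + 1) : ℝ) = 2 * (4 / 5 / 2 ^ (n + 2)) := by
      rw [pow_succ _ (n + 1)]
      field_simp
    rw [hpow] at hb
    rw [show n + 1 + 1 = n + 2 from rfl]
    push_cast
    linarith

/-- inner `ℓ∞` ball of the primal polytope.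
For every `k`, the point `z̄ = (0, 0, (1/6, 1/6), (1/30)·1_k, 1/3)` satisfies
`z̄ + (1/30)·B_∞^{k+5} ⊆ P`: any point whose coordinates all lie within `1/30` of the
corresponding coordinates of `z̄` belongs to `P`. -/
theorem stmt_16 (k : ℕ) (x y : ℝ) (p0 : ℝ × ℝ) (t : Fin k → ℝ) (s : ℝ)
    (hx : |x - 0| ≤ 1 / 30) (hy : |y - 0| ≤ 1 / 30)
    (hp1 : |p0.1 - 1 / 6| ≤ 1 / 30) (hp2 : |p0.2 - 1 / 6| ≤ 1 / 30)
    (ht : ∀ i, |t i - 1 / 30| ≤ 1 / 30) (hs : |s - 1 / 3| ≤ 1 / 30) :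
    memP k x y p0 t s := by
  rw [sub_zero] at hx hy
  rw [abs_le] at hp1 hp2 hs
  let T : ℕ → ℝ := fun n => if h : n < k then t ⟨n, h⟩ else 0
  have hTt : ∀ i : Fin k, T i = t i := fun i => by simp [T]
  have ht' : ∀ i, 0 ≤ t i ∧ t i ≤ 1 / 15 := fun i => by
    have := abs_le.1 (ht i)
    constructor <;> linarith
  have hT : ∀ n, 0 ≤ T n ∧ T n ≤ 1 / 15 := fun n => by
    by_cases h : n < k
    · simpa only [T, dif_pos h] using ht' ⟨n, h⟩
    · simp [T, h]
  let u : ℕ → ℝ := fun n => T n + (n + 1) * s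
  have hlow : ∀ n : ℕ, 3 / 10 * ((n : ℝ) + 1) ≤ u n := fun n => by
    have hn : (0 : ℝ) ≤ n := n.cast_nonneg
    simp only [u]
    nlinarith [hT n]
  have hu0 : ∀ n, 0 ≤ u n := fun n => le_trans (by positivity) (hlow n)
  have hu : ∀ n : ℕ, u n ≤ (11 * (n + 1) + 2) / 30 := fun n => by
    have hn : (0 : ℝ) ≤ n := n.cast_nonneg
    simp only [u]
    nlinarith [hT n]
  have hmono : ∀ n, u n ≤ u (n + 1) := fun n => by
    simp only [u]
    push_cast
    linarith [hT n, hT (n + 1)]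
  have hA := wdot_liftPoint_bounds hu0 hu (p0 := p0) (by linarith) (by linarith)
    (by linarith) (by linarith)
  refine ⟨fun i => liftPoint u p0 i, rfl, ?_, ?_, fun i => ?_, fun i => ?_, fun i => ?_, ?_,
    fun i => ?_, by linarith, by linarith⟩
  · change |x| ≤ p0.1
    linarith
  · change |y| ≤ p0.2
    linarith
  · exact wdot_liftPoint_succ u p0 i
  · rw [← hTt i]
    exact (vdot_liftPoint_succ u p0 i).symm
  · simp only [Fin.val_succ, Fin.val_castSucc, vdot_liftPoint_succ]
    generalize (i : ℕ) = n
    have hs0 := sin_ang_nonneg (n + 1)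
    have hc0 := cos_ang_nonneg (n + 1)
    have hs1 := Real.sin_le_one (ang (n + 1))
    have hc1 := Real.cos_le_one (ang (n + 1))
    have hn := hlow n
    rw [abs_le]
    cases n with
    | zero =>
      simp only [vdot, liftPoint]
      norm_num at hn hs0 hc0 hs1 hc1 ⊢
      constructor <;> nlinarith
    | succ n =>
      rw [vdot_next_liftPoint_succ]
      obtain ⟨ha, hb⟩ := hA n
      have ha' : wdot (n + 1) (liftPoint u p0 n) ≤ 18 / 25 :=
        le_trans (le_add_of_nonneg_right (by positivity)) hb
      have hsin : Real.sin (ang (n + 2)) ≤ 1 / 5 := by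
        refine (sin_ang_le (n + 2)).trans ?_
        rw [pow_add, div_le_iff₀ (by positivity)]
        have : (1 : ℝ) ≤ 2 ^ n := one_le_pow₀ (by norm_num)
        linarith
      have hprod := mul_le_mul hsin ha' ha (by norm_num)
      have hprod0 := mul_nonneg hs0 ha
      have hcu := mul_le_of_le_one_left (hu0 n) hc1
      have hcu0 := mul_nonneg hc0 (hu0 n)
      have hn0 : (0 : ℝ) ≤ n := n.cast_nonneg
      push_cast at hn
      constructor
      · linarith
      · linarith [hmono n]
  · simp only [Fin.val_last]
    cases k with
    | zero =>
      simp only [liftPoint]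
      linarith
    | succ n =>
      simp only [liftPoint]
      obtain ⟨ha, hb⟩ := hA n
      have hca := mul_le_of_le_one_left ha (Real.cos_le_one (ang (n + 1)))
      have hsu := mul_le_mul (sin_ang_le (n + 1)) (hu n) (hu0 n) (by positivity)
      have hpos : (0 : ℝ) ≤ 4 / 5 / 2 ^ (n + 1) := by positivity
      linarith
  · exact ⟨(ht' i).1, (ht' i).2.trans (by norm_num)⟩
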